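/- arXiv:1905.13371 — 2 statements merged into one kernel-verified Lean document; each statement's English description precedes it below -/
import Mathlib

section
/- Let B be a base and S ⊆ V a subset such that C[S] is nonsingular, where C is the fundamental cocircuit matrix with respect to B. Write C in block form C = [[α, β],[γ, δ]] with α = C[S∩B, S∖B], β = C[S∩B, (V∖B)∖S], γ = C[B∖S, S∖B], δ = C[B∖S, (V∖B)∖S]. Then B △ S is a base, and the matrix C' = [[α⁻¹, α⁻¹β],[−γα⁻¹, δ − γα⁻¹β]], with its first block row indexed by S∖B, second block row by B∖S, first block column by S∩B, and second block column by (V∖B)∖S, is the fundamental cocircuit matrix with respect to B △ S. -/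
open Matrix

/-- A matrix whose row and column index types may differ is *nonsingular* if there is an
index bijection under which its determinant is nonzero.  (This forces the two index sets
to have the same cardinality; the empty matrix is nonsingular by convention.) -/
def Matrix.Nonsing {K : Type*} [CommRing K] {α β : Type*} [Fintype α] [Fintype β]
    [DecidableEq α] (M : Matrix α β K) : Prop :=
  ∃ e : α ≃ β, (M.submatrix id e).det ≠ 0

/-- The inclusion map between the coercions of two finsets, one contained in the other. -/
def Finset.incl {V : Type*} {P Q : Finset V} (h : P ⊆ Q) (x : ↥P) : ↥Q := ⟨x.1, h x.2⟩

/-- `B` is a base of the column matroid of `A`: `|B| = |U|` and `A[U,B]` is nonsingular. -/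
def Matrix.IsBase {K U V : Type*} [CommRing K] [Fintype U] [Fintype V] [DecidableEq U]
    (A : Matrix U V K) (B : Finset V) : Prop :=
  Matrix.Nonsing (A.submatrix id (fun b : ↥B => (b : V)))

/-- `C` is the fundamental cocircuit matrix of `A` with respect to the base `B`, i.e.
`C = A[U,B]⁻¹ · A[U, V∖B]`, expressed as `A[U,B] * C = A[U, V∖B]`. -/
def Matrix.IsCocircuitMatrix {K U V : Type*} [CommRing K] [Fintype U] [Fintype V]
    [DecidableEq V] (A : Matrix U V K) (B : Finset V) (C : Matrix ↥B ↥(Bᶜ) K) : Prop :=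
  A.submatrix id (fun b : ↥B => (b : V)) * C = A.submatrix id (fun v : ↥(Bᶜ) => (v : V))

/-- The submatrix `C[X] = C[X ∩ B, X ∖ B]` of a matrix `C` with row set `B` and column
set `V ∖ B`. -/
def csub {K V : Type*} [CommRing K] [Fintype V] [DecidableEq V] (B : Finset V)
    (C : Matrix ↥B ↥(Bᶜ) K) (X : Finset V) : Matrix ↥(X ∩ B) ↥(X \ B) K :=
  C.submatrix (Finset.incl Finset.inter_subset_right)
    (Finset.incl (by intro a ha; exact Finset.mem_compl.mpr (Finset.mem_sdiff.mp ha).2))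

/-- `C'` is the matrix obtained from `Cs` (with row set `Bs` and column set `Bsᶜ`) by
*pivoting around* `X`: writing `Cs = [[α, β], [γ, δ]]` with `α = Cs[X∩Bs, X∖Bs]`,
`β = Cs[X∩Bs, Bsᶜ∖X]`, `γ = Cs[Bs∖X, X∖Bs]`, `δ = Cs[Bs∖X, Bsᶜ∖X]`, the matrix `C'`
(with row set `Bs △ X` and column set `(Bs △ X)ᶜ`) has blocks
`C'[X∖Bs, X∩Bs] = α⁻¹`, `C'[X∖Bs, Bsᶜ∖X] = α⁻¹β`, `C'[Bs∖X, X∩Bs] = −γα⁻¹`, and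
`C'[Bs∖X, Bsᶜ∖X] = δ − γα⁻¹β`. -/
def IsPivot {K W : Type*} [Field K] [Fintype W] [DecidableEq W] (Bs X : Finset W)
    (Cs : Matrix ↥Bs ↥(Bsᶜ) K)
    (C' : Matrix ↥(symmDiff Bs X) ↥((symmDiff Bs X)ᶜ) K) : Prop :=
  let hXB : X ∩ Bs ⊆ Bs := Finset.inter_subset_right
  let hXBc : X \ Bs ⊆ Bsᶜ := by
    intro a ha; exact Finset.mem_compl.mpr (Finset.mem_sdiff.mp ha).2
  let hBX : Bs \ X ⊆ Bs := Finset.sdiff_subset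
  let hBcX : Bsᶜ \ X ⊆ Bsᶜ := Finset.sdiff_subset
  let hr1 : X \ Bs ⊆ symmDiff Bs X := by
    intro a ha; rw [Finset.mem_symmDiff]
    exact Or.inr ⟨(Finset.mem_sdiff.mp ha).1, (Finset.mem_sdiff.mp ha).2⟩
  let hr2 : Bs \ X ⊆ symmDiff Bs X := by
    intro a ha; rw [Finset.mem_symmDiff]
    exact Or.inl ⟨(Finset.mem_sdiff.mp ha).1, (Finset.mem_sdiff.mp ha).2⟩
  let hc1 : X ∩ Bs ⊆ (symmDiff Bs X)ᶜ := by
    intro a ha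
    rw [Finset.mem_inter] at ha
    rw [Finset.mem_compl, Finset.mem_symmDiff]
    push_neg
    exact ⟨fun _ => ha.1, fun _ => ha.2⟩
  let hc2 : Bsᶜ \ X ⊆ (symmDiff Bs X)ᶜ := by
    intro a ha
    rw [Finset.mem_sdiff, Finset.mem_compl] at ha
    rw [Finset.mem_compl, Finset.mem_symmDiff]
    push_neg
    exact ⟨fun h => absurd h ha.1, fun h => absurd h ha.2⟩
  let α := Cs.submatrix (Finset.incl hXB) (Finset.incl hXBc)
  let β := Cs.submatrix (Finset.incl hXB) (Finset.incl hBcX)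
  let γ := Cs.submatrix (Finset.incl hBX) (Finset.incl hXBc)
  let δ := Cs.submatrix (Finset.incl hBX) (Finset.incl hBcX)
  let C11 := C'.submatrix (Finset.incl hr1) (Finset.incl hc1)
  let C12 := C'.submatrix (Finset.incl hr1) (Finset.incl hc2)
  let C21 := C'.submatrix (Finset.incl hr2) (Finset.incl hc1)
  let C22 := C'.submatrix (Finset.incl hr2) (Finset.incl hc2)
  α * C11 = 1 ∧ C11 * α = 1 ∧ α * C12 = β ∧ C21 * α = -γ ∧ C22 = δ - γ * C12

theorem Matrix.mul_eq_add_submatrix_incl {K V m n : Type*} [CommRing K] [DecidableEq V]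
    {P Q T : Finset V} (hP : P ⊆ T) (hQ : Q ⊆ T) (hd : Disjoint P Q) (hT : T ⊆ P ∪ Q)
    (M : Matrix m T K) (N : Matrix T n K) :
    M * N = M.submatrix id (Finset.incl hP) * N.submatrix (Finset.incl hP) id +
      M.submatrix id (Finset.incl hQ) * N.submatrix (Finset.incl hQ) id := by
  ext i j
  obtain rfl : T = P ∪ Q := hT.antisymm (Finset.union_subset hP hQ)
  let f : V → K := fun v => if h : v ∈ P ∪ Q then M i ⟨v, h⟩ * N ⟨v, h⟩ j else 0
  have hf (R : Finset V) (hR : R ⊆ P ∪ Q) :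
      ∑ x : R, M i (Finset.incl hR x) * N (Finset.incl hR x) j = ∑ v ∈ R, f v := by
    rw [← Finset.sum_coe_sort R f]
    refine Finset.sum_congr rfl fun x _ => ?_
    simp only [f, dif_pos (hR x.2), Finset.incl]
  simp only [Matrix.add_apply, Matrix.mul_apply, Matrix.submatrix_apply, id_eq]
  rw [hf P hP, hf Q hQ, ← Finset.sum_union hd]
  exact hf _ subset_rfl

/-- A nonsingular matrix over a field has a two-sided inverse. -/
theorem Matrix.Nonsing.exists_inverse {K m n : Type*} [Field K] [Fintype m] [Fintype n]
    [DecidableEq m] [DecidableEq n] {M : Matrix m n K} (hM : M.Nonsing) :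
    ∃ N : Matrix n m K, M * N = 1 ∧ N * M = 1 := by
  obtain ⟨e, he⟩ := hM
  have hu : IsUnit (M.submatrix id e).det := isUnit_iff_ne_zero.mpr he
  have hM : M = (M.submatrix id e).submatrix id e.symm := by simp
  generalize M.submatrix id e = Q at hu hM
  subst hM
  refine ⟨Q⁻¹.submatrix e.symm id, ?_, ?_⟩
  · rw [Matrix.submatrix_mul_equiv, Matrix.mul_nonsing_inv _ hu, Matrix.submatrix_id_id]
  · rw [← Matrix.submatrix_mul _ _ _ _ _ Function.bijective_id, Matrix.nonsing_inv_mul _ hu,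
      Matrix.submatrix_one_equiv]

/-- If the columns of `A` in `B` span all other columns, `A` has full row rank, and `B` has the
right cardinality, then `B` is a base. -/
theorem Matrix.IsCocircuitMatrix.isBase {K U V : Type*} [Field K] [Fintype U] [Fintype V]
    [DecidableEq U] [DecidableEq V] {A : Matrix U V K} {B : Finset V}
    {C : Matrix ↥B ↥(Bᶜ) K} (hC : A.IsCocircuitMatrix B C)
    (hrank : A.rank = Fintype.card U) (hcard : Fintype.card U = B.card) : A.IsBase B := by
  set M := A.submatrix id (fun b : ↥B => (b : V)) with hM
  have hfac : A = M * Matrix.of fun (b : B) (v : V) =>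
      if h : v ∈ B then (1 : Matrix B B K) b ⟨v, h⟩ else C b ⟨v, Finset.mem_compl.mpr h⟩ := by
    ext u v
    by_cases h : v ∈ B
    · have := congrFun₂ (Matrix.mul_one M) u ⟨v, h⟩
      simpa [Matrix.mul_apply, h, hM] using this.symm
    · have := congrFun₂ hC u ⟨v, Finset.mem_compl.mpr h⟩
      simpa [Matrix.mul_apply, h, hM] using this.symm
  have hle : Fintype.card U ≤ M.rank := by
    rw [← hrank]
    conv_lhs => rw [hfac]
    exact Matrix.rank_mul_le_left _ _
  let e : U ≃ B := Fintype.equivOfCardEq (by simpa using hcard)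
  refine ⟨e, ?_⟩
  have hr : (M.submatrix id e).rank = Fintype.card U := by
    refine le_antisymm (Matrix.rank_le_card_width _) (hle.trans_eq ?_)
    exact (Matrix.rank_submatrix M (Equiv.refl U) e).symm
  rw [Matrix.rank_eq_finrank_span_row] at hr
  exact ((Matrix.isUnit_iff_isUnit_det _).mp <| Matrix.linearIndependent_rows_iff_isUnit.mp <|
    linearIndependent_iff_card_eq_finrank_span.mpr hr.symm).ne_zero

theorem Matrix.mul_add_mul_eq_of_pivot_left {K u m n p : Type*} [CommRing K] [Fintype m]
    [Fintype n] [Fintype p] [DecidableEq m] {x : Matrix u m K} {y : Matrix u n K}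
    {z : Matrix u p K} {α : Matrix m p K} {γ : Matrix n p K} {α' : Matrix p m K}
    {γ' : Matrix n m K} (hz : x * α + y * γ = z) (hα : α * α' = 1) (hγ : γ' * α = -γ) :
    z * α' + y * γ' = x := by
  have h : γ' = -(γ * α') := by
    rw [← Matrix.neg_mul, ← hγ, Matrix.mul_assoc, hα, Matrix.mul_one]
  rw [← hz, h, Matrix.add_mul, Matrix.mul_assoc, hα, Matrix.mul_one, Matrix.mul_assoc,
    Matrix.mul_neg, add_neg_cancel_right]

theorem Matrix.mul_add_mul_eq_of_pivot_right {K u m n p q : Type*} [CommRing K] [Fintype m]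
    [Fintype n] [Fintype p] {x : Matrix u m K} {y : Matrix u n K} {z : Matrix u p K}
    {w : Matrix u q K} {α : Matrix m p K} {β : Matrix m q K} {γ : Matrix n p K}
    {δ : Matrix n q K} {β' : Matrix p q K} {δ' : Matrix n q K} (hz : x * α + y * γ = z)
    (hw : x * β + y * δ = w) (hβ : α * β' = β) (hδ : δ' = δ - γ * β') :
    z * β' + y * δ' = w := by
  rw [← hz, ← hw, hδ, ← hβ, Matrix.add_mul, Matrix.mul_sub, Matrix.mul_assoc, Matrix.mul_assoc]
  abel

theorem IsPivot.isCocircuitMatrix {K U V : Type*} [Field K] [Fintype U] [Fintype V]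
    [DecidableEq V] {A : Matrix U V K} {B S : Finset V}
    {C : Matrix ↥B ↥(Bᶜ) K} {C' : Matrix ↥(symmDiff B S) ↥((symmDiff B S)ᶜ) K}
    (h : IsPivot B S C C') (hC : A.IsCocircuitMatrix B C) :
    A.IsCocircuitMatrix (symmDiff B S) C' := by
  obtain ⟨h1, h2, h3, h4, h5⟩ := h
  unfold Matrix.IsCocircuitMatrix at hC ⊢
  rw [Matrix.mul_eq_add_submatrix_incl (P := S ∩ B) (Q := B \ S) (by grind) (by grind)
    (by rw [Finset.disjoint_left]; grind) (by grind)] at hC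
  rw [Matrix.mul_eq_add_submatrix_incl (P := S \ B) (Q := B \ S)
    (by grind [Finset.mem_compl, Finset.mem_symmDiff]) (by grind [Finset.mem_symmDiff])
    (by rw [Finset.disjoint_left]; grind) (by grind [Finset.mem_compl, Finset.mem_symmDiff])]
  let a (R : Finset V) : Matrix U R K := A.submatrix id Subtype.val
  have e1 : a (S ∩ B) * _ + a (B \ S) * _ = a (S \ B) := congrArg (fun M => M.submatrix id
    (Finset.incl (P := S \ B) (Q := Bᶜ) (by intro; grind [Finset.mem_compl]))) hC
  have e2 : a (S ∩ B) * _ + a (B \ S) * _ = a (Bᶜ \ S) := congrArg (fun M => M.submatrix id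
    (Finset.incl (P := Bᶜ \ S) (Q := Bᶜ) (by intro; grind [Finset.mem_compl]))) hC
  have f1 := Matrix.mul_add_mul_eq_of_pivot_left e1 h1 h4
  have f2 := Matrix.mul_add_mul_eq_of_pivot_right e1 e2 h3 h5
  ext u v
  have hv := v.2
  rw [Finset.mem_compl, Finset.mem_symmDiff] at hv
  by_cases hvS : v.1 ∈ S
  · exact congrFun₂ f1 u ⟨v, by grind⟩
  · exact congrFun₂ f2 u ⟨v, by grind [Finset.mem_compl, Finset.mem_symmDiff]⟩

theorem exists_isPivot {K V : Type*} [Field K] [Fintype V] [DecidableEq V] {B S : Finset V}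
    {C : Matrix ↥B ↥(Bᶜ) K} (hS : Matrix.Nonsing (csub B C S)) :
    ∃ C' : Matrix ↥(symmDiff B S) ↥((symmDiff B S)ᶜ) K, IsPivot B S C C' := by
  obtain ⟨N, h1, h2⟩ := hS.exists_inverse
  have hSB : S ∩ B ⊆ B := Finset.inter_subset_right
  have hSBc : S \ B ⊆ Bᶜ := by intro; grind [Finset.mem_compl]
  have hBS : B \ S ⊆ B := Finset.sdiff_subset
  have hBcS : Bᶜ \ S ⊆ Bᶜ := Finset.sdiff_subset
  have hr1 : S \ B ⊆ symmDiff B S := by intro; grind [Finset.mem_symmDiff]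
  have hr2 : B \ S ⊆ symmDiff B S := by intro; grind [Finset.mem_symmDiff]
  have hc1 : S ∩ B ⊆ (symmDiff B S)ᶜ := by intro; grind [Finset.mem_compl, Finset.mem_symmDiff]
  have hc2 : Bᶜ \ S ⊆ (symmDiff B S)ᶜ := by intro; grind [Finset.mem_compl, Finset.mem_symmDiff]
  let β := C.submatrix (Finset.incl hSB) (Finset.incl hBcS)
  let γ := C.submatrix (Finset.incl hBS) (Finset.incl hSBc)
  let δ := C.submatrix (Finset.incl hBS) (Finset.incl hBcS)
  have hrow (i : ↥(symmDiff B S)) : i.1 ∉ S → i.1 ∈ B \ S := by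
    grind [Finset.mem_compl, Finset.mem_symmDiff]
  have hrow' (i : ↥(symmDiff B S)) : i.1 ∈ S → i.1 ∈ S \ B := by
    grind [Finset.mem_compl, Finset.mem_symmDiff]
  have hcol (j : ↥((symmDiff B S)ᶜ)) : j.1 ∈ S → j.1 ∈ S ∩ B := by
    grind [Finset.mem_compl, Finset.mem_symmDiff]
  have hcol' (j : ↥((symmDiff B S)ᶜ)) : j.1 ∉ S → j.1 ∈ Bᶜ \ S := by
    grind [Finset.mem_compl, Finset.mem_symmDiff]
  let C' : Matrix ↥(symmDiff B S) ↥((symmDiff B S)ᶜ) K := Matrix.of fun i j =>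
    if hi : i.1 ∈ S then
      if hj : j.1 ∈ S then N ⟨i, hrow' i hi⟩ ⟨j, hcol j hj⟩
      else (N * β) ⟨i, hrow' i hi⟩ ⟨j, hcol' j hj⟩
    else
      if hj : j.1 ∈ S then (-(γ * N)) ⟨i, hrow i hi⟩ ⟨j, hcol j hj⟩
      else (δ - γ * (N * β)) ⟨i, hrow i hi⟩ ⟨j, hcol' j hj⟩
  have h11 : C'.submatrix (Finset.incl hr1) (Finset.incl hc1) = N := by
    ext i j
    have hi : i.1 ∈ S := by grind
    have hj : j.1 ∈ S := by grind
    simp [C', Finset.incl, hi, hj]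
  have h12 : C'.submatrix (Finset.incl hr1) (Finset.incl hc2) = N * β := by
    ext i j
    have hi : i.1 ∈ S := by grind
    have hj : j.1 ∉ S := by grind
    simp [C', Finset.incl, hi, hj]
  have h21 : C'.submatrix (Finset.incl hr2) (Finset.incl hc1) = -(γ * N) := by
    ext i j
    have hi : i.1 ∉ S := by grind
    have hj : j.1 ∈ S := by grind
    simp [C', Finset.incl, hi, hj]
  have h22 : C'.submatrix (Finset.incl hr2) (Finset.incl hc2) = δ - γ * (N * β) := by
    ext i j
    have hi : i.1 ∉ S := by grind
    have hj : j.1 ∉ S := by grind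
    simp [C', Finset.incl, hi, hj]
  have h12' : csub B C S * (N * β) = β := by rw [← Matrix.mul_assoc, h1, Matrix.one_mul]
  have h21' : -(γ * N) * csub B C S = -γ := by
    rw [Matrix.neg_mul, Matrix.mul_assoc, h2, Matrix.mul_one]
  refine ⟨C', ?_⟩
  unfold IsPivot
  dsimp only
  rw [h11, h12, h21, h22]
  exact ⟨h1, h2, h12', h21', rfl⟩

theorem card_symmDiff_of_nonsing {K V : Type*} [Field K] [Fintype V] [DecidableEq V]
    {B S : Finset V} {C : Matrix ↥B ↥(Bᶜ) K} (hS : Matrix.Nonsing (csub B C S)) :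
    (symmDiff B S).card = B.card := by
  obtain ⟨e, -⟩ := hS
  have h : (S ∩ B).card = (S \ B).card := by
    simpa only [Fintype.card_coe] using Fintype.card_congr e
  rw [symmDiff_def, Finset.sup_eq_union, Finset.card_union_of_disjoint disjoint_sdiff_sdiff,
    ← h, Finset.inter_comm]
  exact Finset.card_sdiff_add_card_inter B S

/-- **Pivoting yields the fundamental cocircuit matrix of the exchanged base.**
Let `B` be a base of the column matroid of a full-row-rank matrix `A`, `C` the
fundamental cocircuit matrix with respect to `B`, and `S ⊆ V` a subset with `C[S]`
nonsingular.  Then `B △ S` is a base, and the matrix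
`C' = [[α⁻¹, α⁻¹β], [−γα⁻¹, δ − γα⁻¹β]]` obtained from `C = [[α, β], [γ, δ]]`
(with `α = C[S∩B, S∖B]`, `β = C[S∩B, (V∖B)∖S]`, `γ = C[B∖S, S∖B]`,
`δ = C[B∖S, (V∖B)∖S]`) by pivoting around `S` — which exists and is characterized by
`IsPivot` — is the fundamental cocircuit matrix with respect to `B △ S`. -/
theorem pivot_isCocircuitMatrix {K U V : Type*} [Field K] [Fintype U] [Fintype V]
    [DecidableEq U] [DecidableEq V]
    (A : Matrix U V K) (hrank : A.rank = Fintype.card U)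
    (B : Finset V) (hB : A.IsBase B)
    (C : Matrix ↥B ↥(Bᶜ) K) (hC : A.IsCocircuitMatrix B C)
    (S : Finset V) (hS : Matrix.Nonsing (csub B C S)) :
    A.IsBase (symmDiff B S) ∧
    (∃ C' : Matrix ↥(symmDiff B S) ↥((symmDiff B S)ᶜ) K, IsPivot B S C C') ∧
    (∀ C' : Matrix ↥(symmDiff B S) ↥((symmDiff B S)ᶜ) K,
      IsPivot B S C C' → A.IsCocircuitMatrix (symmDiff B S) C') := by
  have hpivot := exists_isPivot hS
  refine ⟨?_, hpivot, fun C' h => h.isCocircuitMatrix hC⟩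
  obtain ⟨C', h⟩ := hpivot
  obtain ⟨e, -⟩ := hB
  refine (h.isCocircuitMatrix hC).isBase hrank ?_
  rw [card_symmDiff_of_nonsing hS]
  simpa using Fintype.card_congr e
end

section
/- Let B be a base and C the fundamental cocircuit matrix with respect to B. For every subset S ⊆ V, the set B △ S is a base if and only if C[S] is nonsingular. -/
open Matrix

namespace Matrix

variable {K : Type*} [Field K]

/-- Over a field, a matrix is nonsingular iff multiplication by it is bijective on vectors. -/
theorem nonsing_iff_bijective_mulVec {α β : Type*} [Fintype α] [Fintype β] [DecidableEq α]
    (M : Matrix α β K) : M.Nonsing ↔ Function.Bijective M.mulVec := by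
  have key (e : α ≃ β) :
      (M.submatrix id e).det ≠ 0 ↔ Function.Bijective M.mulVec := by
    have hcomp : (M.submatrix id e).mulVec = M.mulVec ∘ fun x => x ∘ e.symm := by
      funext x
      simpa using submatrix_mulVec_equiv M x id e
    rw [← isUnit_iff_ne_zero, ← isUnit_iff_isUnit_det]
    have hbij : Function.Bijective fun x : α → K => x ∘ e.symm :=
      (e.arrowCongr (Equiv.refl K)).bijective
    rw [← Function.Bijective.of_comp_iff _ hbij, ← hcomp]
    exact ⟨fun h => ⟨mulVec_injective_iff_isUnit.2 h, mulVec_surjective_iff_isUnit.2 h⟩,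
      fun h => mulVec_injective_iff_isUnit.1 h.1⟩
  constructor
  · rintro ⟨e, he⟩
    exact (key e).1 he
  · intro h
    have hcard : Fintype.card β = Fintype.card α := by
      simpa using (LinearEquiv.ofBijective M.mulVecLin h).finrank_eq
    exact ⟨Fintype.equivOfCardEq hcard.symm, (key _).2 h⟩

theorem nonsing_submatrix_equiv_iff {α α' β β' : Type*} [Fintype α] [Fintype α'] [Fintype β]
    [Fintype β'] [DecidableEq α] [DecidableEq α'] (M : Matrix α β K) (e : α' ≃ α)
    (f : β' ≃ β) : (M.submatrix e f).Nonsing ↔ M.Nonsing := by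
  have hcomp : (M.submatrix e f).mulVec =
      (fun y => y ∘ e) ∘ M.mulVec ∘ fun x => x ∘ f.symm := by
    funext x
    exact submatrix_mulVec_equiv M x e f
  have he : Function.Bijective fun y : α → K => y ∘ e :=
    (e.symm.arrowCongr (Equiv.refl K)).bijective
  have hf : Function.Bijective fun x : β' → K => x ∘ f.symm :=
    (f.arrowCongr (Equiv.refl K)).bijective
  rw [nonsing_iff_bijective_mulVec, nonsing_iff_bijective_mulVec, hcomp,
    Function.Bijective.of_comp_iff' he, Function.Bijective.of_comp_iff _ hf]

theorem Nonsing.mul_iff {α β γ : Type*} [Fintype α] [Fintype β] [Fintype γ] [DecidableEq α]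
    [DecidableEq β] {P : Matrix α β K} (hP : P.Nonsing) (M : Matrix β γ K) :
    (P * M).Nonsing ↔ M.Nonsing := by
  have hcomp : (P * M).mulVec = P.mulVec ∘ M.mulVec := by
    funext x
    simp
  rw [nonsing_iff_bijective_mulVec, nonsing_iff_bijective_mulVec, hcomp,
    Function.Bijective.of_comp_iff' ((nonsing_iff_bijective_mulVec P).1 hP)]

theorem nonsing_fromBlocks_one_zero_iff {α β γ : Type*} [Fintype α] [Fintype β] [Fintype γ]
    [DecidableEq α] [DecidableEq β] (X : Matrix α γ K) (Y : Matrix β γ K) :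
    (fromBlocks (1 : Matrix α α K) X 0 Y).Nonsing ↔ Y.Nonsing := by
  have hmul (x : α → K) (y : γ → K) : (fromBlocks (1 : Matrix α α K) X 0 Y) *ᵥ Sum.elim x y =
      Sum.elim (x + X *ᵥ y) (Y *ᵥ y) := by
    simp [fromBlocks_mulVec]
  rw [nonsing_iff_bijective_mulVec, nonsing_iff_bijective_mulVec]
  constructor
  · refine fun h => ⟨fun y y' hy => ?_, fun z => ?_⟩
    · have := @h.1 (Sum.elim (-(X *ᵥ y)) y) (Sum.elim (-(X *ᵥ y')) y')
        (by simp only [hmul, neg_add_cancel, hy])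
      simpa using congrArg (· ∘ Sum.inr) this
    · obtain ⟨v, hv⟩ := h.2 (Sum.elim 0 z)
      rw [← Sum.elim_comp_inl_inr v, hmul] at hv
      exact ⟨v ∘ Sum.inr, by simpa using congrArg (· ∘ Sum.inr) hv⟩
  · refine fun h => ⟨fun v w hvw => ?_, fun z => ?_⟩
    · rw [← Sum.elim_comp_inl_inr v, ← Sum.elim_comp_inl_inr w, hmul, hmul] at hvw
      have hr : v ∘ Sum.inr = w ∘ Sum.inr :=
        h.1 (by simpa using congrArg (· ∘ Sum.inr) hvw)
      have hl : v ∘ Sum.inl = w ∘ Sum.inl := by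
        simpa [hr] using congrArg (· ∘ Sum.inl) hvw
      rw [← Sum.elim_comp_inl_inr v, ← Sum.elim_comp_inl_inr w, hl, hr]
    · obtain ⟨y, hy⟩ := h.2 (z ∘ Sum.inr)
      exact ⟨Sum.elim (z ∘ Sum.inl - X *ᵥ y) y, by simp [hmul, hy]⟩

end Matrix

/-- **Base exchange via the fundamental cocircuit matrix.**
Let `B` be a base of the column matroid of a full-row-rank matrix `A`, and let `C` be the
fundamental cocircuit matrix with respect to `B`.  Then for every subset `S ⊆ V`, the set
`B △ S` is a base if and only if `C[S]` is nonsingular. -/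
theorem isBase_symmDiff_iff_csub_nonsing {K U V : Type*} [Field K] [Fintype U] [Fintype V]
    [DecidableEq U] [DecidableEq V]
    (A : Matrix U V K) (hrank : A.rank = Fintype.card U)
    (B : Finset V) (hB : A.IsBase B)
    (C : Matrix ↥B ↥(Bᶜ) K) (hC : A.IsCocircuitMatrix B C)
    (S : Finset V) :
    A.IsBase (symmDiff B S) ↔ Matrix.Nonsing (csub B C S) := by
  let e : ↥(B \ S) ⊕ ↥(S ∩ B) ≃ ↥B :=
    (Equiv.Finset.union _ _ (Finset.disjoint_left.2 (by grind))).trans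
      (Equiv.subtypeEquivRight (by grind))
  let f : ↥(B \ S) ⊕ ↥(S \ B) ≃ ↥(symmDiff B S) :=
    (Equiv.Finset.union _ _ (Finset.disjoint_left.2 (by grind))).trans
      (Equiv.subtypeEquivRight (by simp [Finset.mem_symmDiff]))
  let AB := A.submatrix id (fun b : ↥B => (b : V))
  let g : ↥(S \ B) → ↥(Bᶜ) :=
    Finset.incl fun a ha => Finset.mem_compl.mpr (Finset.mem_sdiff.mp ha).2
  have hfactor : (A.submatrix id (fun b : ↥(symmDiff B S) => (b : V))).submatrix id f =
      AB.submatrix id e *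
        fromBlocks 1 (C.submatrix (e ∘ Sum.inl) g) 0 (csub B C S) := by
    ext u (x | y)
    · simp [mul_apply, one_apply, AB, e, f]
    · have h := congrFun (congrFun hC u) (g y)
      rw [mul_apply, ← e.sum_comp, Fintype.sum_sum_type] at h
      rw [mul_apply, Fintype.sum_sum_type]
      exact h.symm
  have hAB : (AB.submatrix id e).Nonsing :=
    (nonsing_submatrix_equiv_iff AB (Equiv.refl U) e).2 hB
  rw [Matrix.IsBase, ← nonsing_submatrix_equiv_iff _ (Equiv.refl U) f]
  simp only [Equiv.coe_refl]
  rw [hfactor, hAB.mul_iff, nonsing_fromBlocks_one_zero_iff]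
end
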